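/- Assume k > 2, let x̄_c = Λ₀·(k−2)/(k·(1+η)), and suppose H'(x̄_c) ≤ 0 and R₀ > 1. Then H has exactly one zero x₄* in (0, Λ₀/(1+η)), so system (★) has exactly one positive equilibrium (x₄*, η·x₄*). -/

import Mathlib

/-- The vector field of system (★):
`x' = x(1+p·x^(k−1))(Λ₀−x−y) − γx`, `y' = ηx − y` (real powers). -/
noncomputable def starVF (p Λ₀ γ η k : ℝ) (q : ℝ × ℝ) : ℝ × ℝ :=
  (q.1 * (1 + p * q.1 ^ (k - 1)) * (Λ₀ - q.1 - q.2) - γ * q.1, η * q.1 - q.2)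

/-- The function `H(x) = (1+p·x^(k−1))·(1 − (1+η)x/Λ₀) − γ/Λ₀`. -/
noncomputable def Hfun (p Λ₀ γ η k : ℝ) (x : ℝ) : ℝ :=
  (1 + p * x ^ (k - 1)) * (1 - (1 + η) * x / Λ₀) - γ / Λ₀

theorem aux_ineq (a t : ℝ) (ha : 0 < a) (ht : 0 < t) (ht1 : t ≠ 1) :
    t ^ a * (1 + a * (1 - t)) < 1 := by
  have h1 : Real.log t < t - 1 := Real.log_lt_sub_one_of_pos ht ht1
  have h2 : -(a * Real.log t) + 1 ≤ Real.exp (-(a * Real.log t)) := Real.add_one_le_exp _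
  have h3 : a * Real.log t < a * (t - 1) := mul_lt_mul_of_pos_left h1 ha
  have h4 : 1 + a * (1 - t) < Real.exp (-(a * Real.log t)) := by linarith
  have h5 : t ^ a = Real.exp (a * Real.log t) := by
    rw [Real.rpow_def_of_pos ht, mul_comm]
  rw [h5]
  calc _ < Real.exp (a * Real.log t) * Real.exp (-(a * Real.log t)) :=
        mul_lt_mul_of_pos_left h4 (Real.exp_pos _)
    _ = 1 := by rw [← Real.exp_add]; simp

theorem Hfun_hasDerivAt (p Λ₀ γ η k x : ℝ) (hx : 0 < x) :
    HasDerivAt (Hfun p Λ₀ γ η k)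
      (p * x ^ (k - 2) * ((k - 1) - k * ((1 + η) / Λ₀) * x) - (1 + η) / Λ₀) x := by
  have h1 : HasDerivAt (fun x : ℝ => x ^ (k - 1)) ((k - 1) * x ^ (k - 1 - 1)) x :=
    Real.hasDerivAt_rpow_const (Or.inl hx.ne')
  have h2 := (h1.const_mul p).const_add 1
  have h3 := ((((hasDerivAt_id x).const_mul (1 + η)).div_const Λ₀).const_sub 1)
  have h4 := (h2.mul h3).sub_const (γ / Λ₀)
  have e : x ^ (k - 1) = x ^ (k - 2) * x := by
    rw [← Real.rpow_add_one hx.ne']; ring_nf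
  have e2 : k - 1 - 1 = k - 2 := by ring
  refine HasDerivAt.congr_deriv (f := Hfun p Λ₀ γ η k) h4 ?_
  simp only [e, e2, id]
  ring

theorem Hfun_strictAnti (p Λ₀ γ η k xc : ℝ)
    (hp : 0 < p) (hΛ : 0 < Λ₀) (hη : 0 < η) (hk : 2 < k)
    (hxcdef : xc = Λ₀ * (k - 2) / (k * (1 + η)))
    (hHxc : deriv (Hfun p Λ₀ γ η k) xc ≤ 0) (hc : Continuous (Hfun p Λ₀ γ η k)) :
    StrictAntiOn (Hfun p Λ₀ γ η k) (Set.Ici 0) := by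
  have hxc : 0 < xc := by
    rw [hxcdef]
    have : 0 < k - 2 := by linarith
    positivity
  have hkc : k * ((1 + η) / Λ₀) * xc = k - 2 := by
    rw [hxcdef]
    have : k ≠ 0 := by linarith
    have : 1 + η ≠ 0 := by linarith
    field_simp
  rw [(Hfun_hasDerivAt p Λ₀ γ η k xc hxc).deriv, hkc] at hHxc
  have key : ∀ x, 0 < x → x ≠ xc → deriv (Hfun p Λ₀ γ η k) x < 0 := by
    intro x hx hne
    rw [(Hfun_hasDerivAt p Λ₀ γ η k x hx).deriv]
    have h := aux_ineq (k - 2) (x / xc) (by linarith) (by positivity)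
      (by rw [Ne, div_eq_one_iff_eq hxc.ne']; exact hne)
    rw [Real.div_rpow hx.le hxc.le] at h
    have hP : 0 < xc ^ (k - 2) := Real.rpow_pos_of_pos hxc _
    have e : (k - 1) - k * ((1 + η) / Λ₀) * x = 1 + (k - 2) * (1 - x / xc) := by
      have h1 : k * ((1 + η) / Λ₀) = (k - 2) / xc := by
        rw [eq_div_iff hxc.ne']; exact hkc
      rw [h1]
      ring
    rw [e]
    have h' : x ^ (k - 2) * (1 + (k - 2) * (1 - x / xc)) < xc ^ (k - 2) := by
      rw [div_mul_eq_mul_div, div_lt_one hP] at h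
      exact h
    have := mul_lt_mul_of_pos_left h' hp
    nlinarith
  have hA : StrictAntiOn (Hfun p Λ₀ γ η k) (Set.Icc 0 xc) := by
    apply strictAntiOn_of_deriv_neg (convex_Icc _ _) hc.continuousOn
    intro x hx
    rw [interior_Icc] at hx
    exact key x hx.1 hx.2.ne
  have hB : StrictAntiOn (Hfun p Λ₀ γ η k) (Set.Ici xc) := by
    apply strictAntiOn_of_deriv_neg (convex_Ici _) hc.continuousOn
    intro x hx
    rw [interior_Ici] at hx
    exact key x (hxc.trans hx) (ne_of_gt hx)
  have := hA.union hB (isGreatest_Icc hxc.le) isLeast_Ici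
  rwa [Set.Icc_union_Ici_eq_Ici hxc.le] at this

/-- For `k > 2`, `x̄_c = Λ₀(k−2)/(k(1+η))`, if `H'(x̄_c) ≤ 0` and
`R₀ > 1`, then `H` has exactly one zero `x₄*` in `(0, Λ₀/(1+η))`, so system (★) has exactly
one positive equilibrium `(x₄*, η·x₄*)`. -/
theorem unique_endemic_equilibrium_of_k_gt_two
    (p Λ₀ γ η k xc : ℝ)
    (hp : 0 < p) (hΛ : 0 < Λ₀) (hη : 0 < η) (hγη : η < γ) (hk : 2 < k)
    (hxcdef : xc = Λ₀ * (k - 2) / (k * (1 + η)))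
    (hHxc : deriv (Hfun p Λ₀ γ η k) xc ≤ 0)
    (hR₀ : 1 < Λ₀ / γ) :
    ∃ x₄ ∈ Set.Ioo (0 : ℝ) (Λ₀ / (1 + η)),
      Hfun p Λ₀ γ η k x₄ = 0 ∧
      (∀ x ∈ Set.Ioo (0 : ℝ) (Λ₀ / (1 + η)), Hfun p Λ₀ γ η k x = 0 → x = x₄) ∧
      starVF p Λ₀ γ η k (x₄, η * x₄) = (0, 0) ∧
      (∀ x y : ℝ, 0 < x → starVF p Λ₀ γ η k (x, y) = (0, 0) → x = x₄ ∧ y = η * x₄) := by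
  have hγ : 0 < γ := hη.trans hγη
  have hc : Continuous (Hfun p Λ₀ γ η k) := by
    have h1 : Continuous (fun x : ℝ => x ^ (k - 1)) :=
      Real.continuous_rpow_const (by linarith)
    unfold Hfun
    fun_prop
  have hanti := Hfun_strictAnti p Λ₀ γ η k xc hp hΛ hη hk hxcdef hHxc hc
  have hL : 0 < Λ₀ / (1 + η) := by positivity
  have h0 : 0 < Hfun p Λ₀ γ η k 0 := by
    have : γ / Λ₀ < 1 := by
      rw [div_lt_one hΛ]; rwa [lt_div_iff₀ hγ, one_mul] at hR₀
    simp only [Hfun, Real.zero_rpow (show k - 1 ≠ 0 by linarith)]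
    simpa using this
  have h1 : Hfun p Λ₀ γ η k (Λ₀ / (1 + η)) < 0 := by
    have e : 1 - (1 + η) * (Λ₀ / (1 + η)) / Λ₀ = 0 := by
      have : 1 + η ≠ 0 := by linarith
      field_simp
      simp
    have : 0 < γ / Λ₀ := by positivity
    simp only [Hfun, e]
    linarith
  obtain ⟨x₄, hx₄, hz⟩ := intermediate_value_Ioo' hL.le hc.continuousOn ⟨h1, h0⟩
  have huniq : ∀ x, 0 < x → Hfun p Λ₀ γ η k x = 0 → x = x₄ := fun x hx h =>
    hanti.injOn (Set.mem_Ici.2 hx.le) (Set.mem_Ici.2 hx₄.1.le) (h.trans hz.symm)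
  have hrel : ∀ x, x * (1 + p * x ^ (k - 1)) * (Λ₀ - x - η * x) - γ * x
      = Λ₀ * x * Hfun p Λ₀ γ η k x := by
    intro x
    unfold Hfun
    field_simp
    ring
  refine ⟨x₄, hx₄, hz, fun x hx h => huniq x hx.1 h, ?_, ?_⟩
  · simp only [starVF, hrel, hz]
    simp
  · intro x y hx h
    simp only [starVF, Prod.mk.injEq] at h
    obtain ⟨ha, hb⟩ := h
    have hy : y = η * x := by linarith
    subst hy
    rw [hrel] at ha
    have hx0 : Λ₀ * x ≠ 0 := by positivity
    have := huniq x hx ((mul_eq_zero.1 ha).resolve_left hx0)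
    subst this
    exact ⟨rfl, rfl⟩
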